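/- Let d ≥ 2, let V ⊂ S^{d-1} be finite, and suppose P = conv V is a d-dimensional polytope whose vertex set is V and which satisfies Property Z. Then P is simplicial: every facet of P (i.e. every (d−1)-dimensional exposed face of P) has exactly d extreme points, and these are affinely independent. -/

import Mathlib

open MeasureTheory Real

/-- Property Z for a polytope inscribed in the unit sphere with vertex set `V`. -/
def PropertyZ {d : ℕ} (V : Set (EuclideanSpace ℝ (Fin d))) : Prop :=
  ∀ p ∈ V, ∃ ε > (0 : ℝ), ∀ q ∈ Metric.sphere (0 : EuclideanSpace ℝ (Fin d)) 1,
    dist q p < ε →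
      volume (convexHull ℝ ((V \ {p}) ∪ {q})) ≤ volume (convexHull ℝ V)

/-- A facet of a `d`-dimensional polytope `P ⊆ ℝ^d` is a `(d-1)`-dimensional exposed face. -/
def IsFacet {d : ℕ} (P F : Set (EuclideanSpace ℝ (Fin d))) : Prop :=
  IsExposed ℝ P F ∧ Module.finrank ℝ (affineSpan ℝ F).direction = d - 1


section aux

open Set

variable {d : ℕ}

local notation "E" => EuclideanSpace ℝ (Fin d)

/-- The fibre of `A` over `x` in direction `v`. -/
def fibre {d : ℕ} (A : Set (EuclideanSpace ℝ (Fin d))) (v x : EuclideanSpace ℝ (Fin d)) : Set ℝ :=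
  {s | x + s • v ∈ A}

/-- A slab which is a fundamental domain for translations along `v`. -/
def slab {d : ℕ} (l : EuclideanSpace ℝ (Fin d) →L[ℝ] ℝ) : Set (EuclideanSpace ℝ (Fin d)) :=
  {x | 0 ≤ l x ∧ l x < 1}

lemma measurableSet_slab (l : E →L[ℝ] ℝ) : MeasurableSet (slab l) :=
  (measurableSet_le measurable_const l.continuous.measurable).inter
    (measurableSet_lt l.continuous.measurable measurable_const)

lemma measurable_fibre {A : Set E} (hA : MeasurableSet A) (v : E) :
    Measurable fun x => volume (fibre A v x) := by
  have h : MeasurableSet {z : E × ℝ | z.1 + z.2 • v ∈ A} := by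
    have : Measurable fun z : E × ℝ => z.1 + z.2 • v := by fun_prop
    exact this hA
  exact measurable_measure_prodMk_left h

lemma volume_eq_fibre {A : Set E} (hA : MeasurableSet A) (l : E →L[ℝ] ℝ) (v : E) (hl : l v = 1) :
    volume A = ∫⁻ x in slab l, volume (fibre A v x) := by
  have hS := measurableSet_slab l
  have hmeas1 : Measurable fun z : E × ℝ => z.1 + z.2 • v := by fun_prop
  have hmeas2 : Measurable fun z : E × ℝ => z.1 - z.2 • v := by fun_prop
  have i1 : Measurable (A.indicator (1 : E → ENNReal)) := measurable_one.indicator hA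
  have i2 : Measurable ((slab l).indicator (1 : E → ENNReal)) := measurable_one.indicator hS
  have e1 : ∫⁻ x in slab l, volume (fibre A v x)
      = ∫⁻ x, ∫⁻ s : ℝ, (slab l).indicator 1 x * A.indicator 1 (x + s • v) := by
    rw [← lintegral_indicator hS]
    refine lintegral_congr fun x => ?_
    rw [lintegral_const_mul]
    · have : (fun s : ℝ => A.indicator (1 : E → ENNReal) (x + s • v))
          = (fibre A v x).indicator 1 := by
        ext s; simp only [fibre, indicator, mem_ofPred_eq]; rfl
      rw [this, lintegral_indicator_one]
      · by_cases hx : x ∈ slab l <;> simp [hx]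
      · have : Measurable fun s : ℝ => x + s • v := by fun_prop
        exact this hA
    · exact i1.comp (by fun_prop)
  have e2 : ∀ s : ℝ, ∫⁻ x, (slab l).indicator 1 x * A.indicator (1 : E → ENNReal) (x + s • v)
      = ∫⁻ x, (slab l).indicator 1 (x - s • v) * A.indicator (1 : E → ENNReal) x := by
    intro s
    rw [← lintegral_add_right_eq_self (μ := (volume : Measure E))
      (fun x => (slab l).indicator 1 (x - s • v) * A.indicator (1 : E → ENNReal) x) (s • v)]
    simp
  rw [e1, lintegral_lintegral_swap, lintegral_congr e2, lintegral_lintegral_swap]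
  · rw [← lintegral_indicator_one hA]
    refine lintegral_congr fun x => ?_
    rw [lintegral_mul_const]
    · have : (fun s : ℝ => (slab l).indicator (1 : E → ENNReal) (x - s • v))
          = (Ioc (l x - 1) (l x)).indicator 1 := by
        ext s
        have : x - s • v ∈ slab l ↔ s ∈ Ioc (l x - 1) (l x) := by
          simp only [slab, mem_ofPred_eq, map_sub, map_smul, hl, smul_eq_mul, mul_one, mem_Ioc]
          constructor <;> rintro ⟨h1, h2⟩ <;> constructor <;> linarith
        by_cases h : x - s • v ∈ slab l
        · simp only [h, this.1 h, indicator_of_mem]; rfl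
        · rw [indicator_of_notMem h, indicator_of_notMem fun h' => h (this.2 h')]
      rw [this, lintegral_indicator_one measurableSet_Ioc]
      simp
    · exact i2.comp (by fun_prop)
  · exact Measurable.aemeasurable
      (((i2.comp (hmeas2.comp measurable_swap)).mul (i1.comp measurable_snd)))
  · exact Measurable.aemeasurable ((i2.comp measurable_fst).mul (i1.comp hmeas1))

lemma shift {T : Set E} (hT : T.Nonempty) {x v m : E} {s : ℝ}
    (h : s ∈ fibre (convexHull ℝ (insert m T)) v x) :
    ∃ c : ℝ, 0 ≤ c ∧ ∀ τ : ℝ, s + c * τ ∈ fibre (convexHull ℝ (insert (m + τ • v) T)) v x := by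
  simp only [fibre, mem_ofPred_eq, convexHull_insert hT, mem_convexJoin, mem_singleton_iff,
    exists_eq_left] at h ⊢
  obtain ⟨y, hy, a, b, ha, hb, hab, e⟩ := h
  refine ⟨a, ha, fun τ => ⟨y, hy, a, b, ha, hb, hab, ?_⟩⟩
  rw [add_smul, ← add_assoc, ← e]
  module

lemma fibre_ge {A : Set E} (hA : Convex ℝ A) {x v : E} {s t : ℝ} (hs : s ∈ fibre A v x)
    (ht : t ∈ fibre A v x) : ENNReal.ofReal (t - s) ≤ volume (fibre A v x) := by
  rw [← Real.volume_Icc]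
  refine measure_mono fun r hr => ?_
  have hc : Convex ℝ (fibre A v x) := by
    intro a ha b hb α β h1 h2 h3
    have := hA ha hb h1 h2 h3
    simp only [fibre, mem_ofPred_eq] at this ⊢
    convert this using 1
    have : x = (α + β) • x := by rw [h3, one_smul]
    nth_rw 1 [this]
    simp only [smul_eq_mul]
    module
  exact hc.ordConnected.out hs ht hr

lemma fibre_compact {A : Set E} (hA : IsCompact A) (l : E →L[ℝ] ℝ) {x v : E} (hl : l v = 1) :
    IsCompact (fibre A v x) := by
  refine IsCompact.of_isClosed_subset (hA.image (f := fun y => l y - l x) (by fun_prop)) ?_ ?_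
  · exact hA.isClosed.preimage (by fun_prop : Continuous fun s : ℝ => x + s • v)
  · intro s hs
    exact ⟨_, hs, by simp [hl]⟩

lemma exists_dual {v : E} (hv : v ≠ 0) : ∃ l : E →L[ℝ] ℝ, l v = 1 := by
  refine ⟨(‖v‖ ^ 2)⁻¹ • innerSL ℝ v, ?_⟩
  have : ‖v‖ ≠ 0 := norm_ne_zero_iff.2 hv
  simp [this]

/-- the volume function -/
noncomputable def volFn {d : ℕ} (T : Set (EuclideanSpace ℝ (Fin d)))
    (q : EuclideanSpace ℝ (Fin d)) : ℝ := (volume (convexHull ℝ (insert q T))).toReal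

lemma hull_compact {T : Set E} (hT : T.Finite) (q : E) :
    IsCompact (convexHull ℝ (insert q T)) := (hT.insert q).isCompact_convexHull ℝ

lemma convexOn_volFn {T : Set E} (hT : T.Nonempty) (hf : T.Finite) :
    ConvexOn ℝ univ (volFn T) := by
  refine ⟨convex_univ, fun a _ b _ α β hα hβ hab => ?_⟩
  by_cases hne : b - a = 0
  · have : b = a := sub_eq_zero.1 hne
    subst this
    rw [← add_smul, ← add_smul, hab, one_smul, one_smul]
  obtain ⟨l, hl⟩ := exists_dual hne
  set v := b - a with hv
  set m := α • a + β • b with hm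
  have ea : m + (-β) • v = a := by
    rw [hm, hv]
    have : a = (α + β) • a := by rw [hab, one_smul]
    nth_rw 3 [this]; module
  have eb : m + α • v = b := by
    rw [hm, hv]
    have : b = (α + β) • b := by rw [hab, one_smul]
    nth_rw 3 [this]; module
  have hA := hull_compact hf a
  have hB := hull_compact hf b
  have hC := hull_compact hf m
  have key : volume (convexHull ℝ (insert m T)) ≤
      ENNReal.ofReal α * volume (convexHull ℝ (insert a T)) +
      ENNReal.ofReal β * volume (convexHull ℝ (insert b T)) := by
    rw [volume_eq_fibre hA.measurableSet l v hl, volume_eq_fibre hB.measurableSet l v hl,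
      volume_eq_fibre hC.measurableSet l v hl, ← lintegral_const_mul' _ _ ENNReal.ofReal_ne_top,
      ← lintegral_const_mul' _ _ ENNReal.ofReal_ne_top, ← lintegral_add_left]
    swap
    · exact (measurable_fibre hA.measurableSet v).const_mul _
    refine lintegral_mono fun x => ?_
    rcases (fibre (convexHull ℝ (insert m T)) v x).eq_empty_or_nonempty with h0 | h0
    · simp [h0]
    have hc := fibre_compact hC l (x := x) hl
    obtain ⟨s₁, h1, h1'⟩ := hc.exists_isLeast h0
    obtain ⟨s₂, h2, h2'⟩ := hc.exists_isGreatest h0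
    obtain ⟨c₁, -, k1⟩ := shift hT h1
    obtain ⟨c₂, -, k2⟩ := shift hT h2
    have a1 := k1 (-β); have a2 := k2 (-β)
    have b1 := k1 α; have b2 := k2 α
    rw [ea] at a1 a2
    rw [eb] at b1 b2
    have ia := fibre_ge (convex_convexHull ℝ _) a1 a2
    have ib := fibre_ge (convex_convexHull ℝ _) b1 b2
    calc volume (fibre (convexHull ℝ (insert m T)) v x) ≤ volume (Icc s₁ s₂) :=
          measure_mono fun r hr => ⟨h1' hr, h2' hr⟩
      _ = ENNReal.ofReal (α * (s₂ + c₂ * (-β) - (s₁ + c₁ * (-β))) +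
            β * (s₂ + c₂ * α - (s₁ + c₁ * α))) := by
          rw [Real.volume_Icc]; congr 1; linear_combination (s₁ - s₂) * hab
      _ ≤ _ := by
          refine ENNReal.ofReal_add_le.trans ?_
          rw [ENNReal.ofReal_mul hα, ENNReal.ofReal_mul hβ]
          gcongr
  have := ENNReal.toReal_mono ?_ key
  · rwa [ENNReal.toReal_add, ENNReal.toReal_mul, ENNReal.toReal_mul, ENNReal.toReal_ofReal hα,
      ENNReal.toReal_ofReal hβ] at this
    · exact ENNReal.mul_ne_top ENNReal.ofReal_ne_top hA.measure_lt_top.ne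
    · exact ENNReal.mul_ne_top ENNReal.ofReal_ne_top hB.measure_lt_top.ne
  · exact ENNReal.add_ne_top.2
      ⟨ENNReal.mul_ne_top ENNReal.ofReal_ne_top hA.measure_lt_top.ne,
       ENNReal.mul_ne_top ENNReal.ofReal_ne_top hB.measure_lt_top.ne⟩

/-- The kink of the volume function at a vertex lying in the hyperplane of a facet. -/
lemma kink {T : Set E} (hf : T.Finite) {p v g : E} (n : E →L[ℝ] ℝ)
    (hnv : 0 < n v) (hn : ∀ y ∈ T, n y ≤ n p) {δ : ℝ} (hδ : 0 < δ)
    (hg : n g = n p)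
    (hball : ∀ x, n x = n p → dist x g < δ → x ∈ convexHull ℝ T) :
    ∃ c > 0, ∀ t > 0, 2 * volFn T p + c * t ≤ volFn T (p - t • v) + volFn T (p + t • v) := by
  have hT : T.Nonempty := by
    rw [← convexHull_nonempty_iff (𝕜 := ℝ)]
    exact ⟨g, hball g hg (by simpa)⟩
  have hv0 : v ≠ 0 := by rintro rfl; simp at hnv
  obtain ⟨l, hl⟩ := exists_dual hv0
  -- choose ε
  obtain ⟨ε, hε, hε'⟩ : ∃ ε : ℝ, 0 < ε ∧ ε * (δ / 2 + dist g p) < δ / 2 := by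
    have hd := dist_nonneg (x := g) (y := p)
    refine ⟨(δ / 4) / (δ / 2 + dist g p), by positivity, ?_⟩
    rw [div_mul_cancel₀ _ (by positivity)]
    linarith
  set lam := ε / (1 + ε) with hlam
  have hlam0 : 0 < lam := by positivity
  -- height of the hyperplane
  set σ : E → ℝ := fun x => (n p - n x) / n v with hσ
  have hσc : Continuous σ := by rw [hσ]; fun_prop
  set D : Set E := {x | dist (x + σ x • v) g < δ / 2} with hD
  have hDo : IsOpen D := isOpen_lt (by fun_prop) continuous_const
  have hσn : ∀ x, n (x + σ x • v) = n p := by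
    intro x; simp only [hσ, map_add, map_smul, smul_eq_mul]; field_simp; ring
  have hDpos : 0 < volume (slab l ∩ D) := by
    have hO : IsOpen ({x | 0 < l x ∧ l x < 1} ∩ D) :=
      ((isOpen_lt continuous_const l.continuous).inter
        (isOpen_lt l.continuous continuous_const)).inter hDo
    have hne : ({x | 0 < l x ∧ l x < 1} ∩ D).Nonempty := by
      refine ⟨g + (1 / 2 - l g) • v, ?_, ?_⟩
      · simp only [mem_ofPred_eq, map_add, map_smul, hl, smul_eq_mul]
        constructor <;> linarith
      · have : σ (g + (1 / 2 - l g) • v) = - (1 / 2 - l g) := by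
          simp only [hσ, map_add, map_smul, smul_eq_mul, hg]; field_simp; ring
        simp only [hD, mem_ofPred_eq, this]
        rw [add_assoc, ← add_smul]; simp [hδ]
    exact (hO.measure_pos volume hne).trans_le
      (measure_mono (inter_subset_inter_left _ fun x hx => ⟨hx.1.le, hx.2⟩))
  -- finite piece
  set w : ENNReal := min (volume (slab l ∩ D)) 1 with hw
  have hwpos : 0 < w := lt_min hDpos one_pos
  have hwt : w ≠ ⊤ := (min_le_right _ _).trans_lt ENNReal.one_lt_top |>.ne
  refine ⟨lam * w.toReal, mul_pos hlam0 (ENNReal.toReal_pos hwpos.ne' hwt), fun t ht => ?_⟩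
  have ea : p + (-t) • v = p - t • v := by module
  have hA := hull_compact hf (p - t • v)
  have hB := hull_compact hf (p + t • v)
  have hC := hull_compact hf p
  have hmono : ∀ q : E, convexHull ℝ T ⊆ convexHull ℝ (insert q T) := fun q =>
    convexHull_mono (subset_insert _ _)
  have key : 2 * volume (convexHull ℝ (insert p T)) + ENNReal.ofReal (lam * t) * w ≤
      volume (convexHull ℝ (insert (p - t • v) T)) +
      volume (convexHull ℝ (insert (p + t • v) T)) := by
    calc _ ≤ 2 * volume (convexHull ℝ (insert p T)) +
          ENNReal.ofReal (lam * t) * volume (slab l ∩ D) := by gcongr; exact min_le_left _ _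
      _ = ∫⁻ x in slab l, (2 * volume (fibre (convexHull ℝ (insert p T)) v x) +
            D.indicator (fun _ => ENNReal.ofReal (lam * t)) x) := by
          rw [lintegral_add_left ((measurable_fibre hC.measurableSet v).const_mul _),
            lintegral_const_mul' _ _ (by simp), ← volume_eq_fibre hC.measurableSet l v hl,
            lintegral_indicator_const hDo.measurableSet,
            Measure.restrict_apply hDo.measurableSet, inter_comm]
      _ ≤ _ := by
          rw [volume_eq_fibre hA.measurableSet l v hl, volume_eq_fibre hB.measurableSet l v hl,
            ← lintegral_add_left (measurable_fibre hA.measurableSet v)]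
          refine lintegral_mono fun x => ?_
          simp only
          have h2eq : ∀ r : ℝ, 2 * ENNReal.ofReal r = ENNReal.ofReal (2 * r) := by
            intro r; rw [ENNReal.ofReal_mul (by norm_num)]; simp
          have hc := fibre_compact hC l (x := x) hl
          by_cases hx : x ∈ D
          · rw [indicator_of_mem hx]
            -- the top point
            have hy : dist (x + σ x • v) g < δ / 2 := hx
            set y := x + σ x • v with hydef
            have hyT : y ∈ convexHull ℝ T := hball y (hσn x) (by linarith)
            set z := y + ε • (y - p) with hz
            have hzT : z ∈ convexHull ℝ T := by
              apply hball
              · simp [hz, hydef ▸ hσn x]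
              · have h1 : dist z y = ε * dist y p := by
                  rw [hz, dist_eq_norm, dist_eq_norm, add_sub_cancel_left, norm_smul,
                    Real.norm_of_nonneg hε.le]
                have h2 : dist y p ≤ δ / 2 + dist g p := by
                  have := dist_triangle y g p; linarith
                have h3 := dist_triangle z y g
                have h4 : ε * dist y p ≤ ε * (δ / 2 + dist g p) := by gcongr
                linarith
            have hpC : σ x ∈ fibre (convexHull ℝ (insert p T)) v x := hmono _ hyT
            have hpA : σ x ∈ fibre (convexHull ℝ (insert (p - t • v) T)) v x := hmono _ hyT
            have hpB : σ x + lam * t ∈ fibre (convexHull ℝ (insert (p + t • v) T)) v x := by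
              have := (convex_convexHull ℝ (insert (p + t • v) T)) (hmono _ hzT)
                (subset_convexHull ℝ _ (mem_insert _ _))
                (a := 1 / (1 + ε)) (b := ε / (1 + ε)) (by positivity) (by positivity)
                (by field_simp)
              simp only [fibre, mem_ofPred_eq]
              convert this using 1
              rw [add_smul, ← add_assoc, ← hydef, hz, hlam]
              have h1 : y = (1 / (1 + ε) + ε / (1 + ε)) • y := by
                rw [← add_div, div_self (by positivity), one_smul]
              have h2 : (1 / (1 + ε)) * ε = ε / (1 + ε) := by ring
              rw [smul_add, smul_smul, h2]
              nth_rw 1 [h1]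
              module
            obtain ⟨s₁, h1, h1'⟩ := hc.exists_isLeast ⟨_, hpC⟩
            have htop : ∀ s ∈ fibre (convexHull ℝ (insert p T)) v x, s ≤ σ x := by
              intro s hs
              have hH : convexHull ℝ (insert p T) ⊆ {y | n y ≤ n p} := by
                apply convexHull_min
                · rintro y (hyp | hy)
                  · rw [hyp]; exact le_refl (n p)
                  · exact hn y hy
                · exact convex_halfSpace_le (f := fun y => n y) n.toLinearMap.isLinear _
              have := hH hs
              simp only [mem_ofPred_eq, map_add, map_smul, smul_eq_mul] at this
              change s ≤ (n p - n x) / n v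
              rw [le_div_iff₀ hnv]; linarith
            obtain ⟨c₁, -, k1⟩ := shift hT h1
            have a1 := k1 (-t)
            have b1 := k1 t
            rw [ea] at a1
            have ia := fibre_ge (convex_convexHull ℝ _) a1 hpA
            have ib := fibre_ge (convex_convexHull ℝ _) b1 hpB
            have hs1 : s₁ ≤ σ x := htop _ h1
            calc _ ≤ 2 * volume (Icc s₁ (σ x)) + ENNReal.ofReal (lam * t) := by
                  gcongr
                  intro r hr; exact ⟨h1' hr, htop r hr⟩
              _ = ENNReal.ofReal ((σ x - (s₁ + c₁ * (-t))) +
                    (σ x + lam * t - (s₁ + c₁ * t))) := by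
                  rw [Real.volume_Icc, h2eq, ← ENNReal.ofReal_add (by linarith) (by positivity)]
                  congr 1; ring
              _ ≤ _ := ENNReal.ofReal_add_le.trans (add_le_add ia ib)
          · rw [indicator_of_notMem hx, add_zero]
            rcases (fibre (convexHull ℝ (insert p T)) v x).eq_empty_or_nonempty with h0 | h0
            · simp [h0]
            obtain ⟨s₁, h1, h1'⟩ := hc.exists_isLeast h0
            obtain ⟨s₂, h2, h2'⟩ := hc.exists_isGreatest h0
            obtain ⟨c₁, -, k1⟩ := shift hT h1
            obtain ⟨c₂, -, k2⟩ := shift hT h2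
            have a1 := k1 (-t); have a2 := k2 (-t)
            have b1 := k1 t; have b2 := k2 t
            rw [ea] at a1 a2
            have ia := fibre_ge (convex_convexHull ℝ _) a1 a2
            have ib := fibre_ge (convex_convexHull ℝ _) b1 b2
            calc _ ≤ 2 * volume (Icc s₁ s₂) := by
                  gcongr
                  intro r hr; exact ⟨h1' hr, h2' hr⟩
              _ = ENNReal.ofReal ((s₂ + c₂ * (-t) - (s₁ + c₁ * (-t))) +
                    (s₂ + c₂ * t - (s₁ + c₁ * t))) := by
                  rw [Real.volume_Icc, h2eq]
                  congr 1; ring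
              _ ≤ _ := ENNReal.ofReal_add_le.trans (add_le_add ia ib)
  have hAt := hA.measure_lt_top (μ := volume) |>.ne
  have hBt := hB.measure_lt_top (μ := volume) |>.ne
  have hCt := hC.measure_lt_top (μ := volume) |>.ne
  have := ENNReal.toReal_mono (ENNReal.add_ne_top.2 ⟨hAt, hBt⟩) key
  rw [ENNReal.toReal_add hAt hBt, ENNReal.toReal_add (ENNReal.mul_ne_top (by simp) hCt)
    (ENNReal.mul_ne_top ENNReal.ofReal_ne_top hwt), ENNReal.toReal_mul, ENNReal.toReal_mul,
    ENNReal.toReal_ofReal (by positivity)] at this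
  simp only [ENNReal.toReal_ofNat] at this
  simp only [volFn]
  linarith

lemma no_local_max {f : E → ℝ} (hf : ConvexOn ℝ univ f) {p v : E} (hp : ‖p‖ = 1) (hv : ‖v‖ = 1)
    (hpv : inner ℝ p v = 0) {c : ℝ} (hc : 0 < c)
    (hk : ∀ t > 0, 2 * f p + c * t ≤ f (p - t • v) + f (p + t • v))
    {ε : ℝ} (hε : 0 < ε) (hmax : ∀ q : E, ‖q‖ = 1 → dist q p < ε → f q ≤ f p) : False := by
  obtain ⟨L, U, hU, hL⟩ := hf.locallyLipschitz p
  obtain ⟨r, hr, hrU⟩ := Metric.mem_nhds_iff.1 hU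
  obtain ⟨t, ht, ht1, ht2, ht3, ht4⟩ :
      ∃ t : ℝ, 0 < t ∧ t ≤ 1 ∧ 2 * t < ε ∧ 2 * t < r ∧ (2 * (L : ℝ)) * t < c := by
    have hL0 : (0 : ℝ) ≤ L := L.2
    refine ⟨min (min 1 (ε / 4)) (min (r / 4) (c / (2 * L + 1) / 2)), by positivity, ?_, ?_, ?_, ?_⟩
    · exact (min_le_left _ _).trans (min_le_left _ _)
    · have := (min_le_left (min 1 (ε / 4)) (min (r / 4) (c / (2 * L + 1) / 2))).trans
        (min_le_right _ _)
      linarith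
    · have := (min_le_right (min 1 (ε / 4)) (min (r / 4) (c / (2 * L + 1) / 2))).trans
        (min_le_left _ _)
      linarith
    · have := (min_le_right (min 1 (ε / 4)) (min (r / 4) (c / (2 * L + 1) / 2))).trans
        (min_le_right _ _)
      calc _ ≤ (2 * (L : ℝ)) * (c / (2 * L + 1) / 2) := by gcongr
        _ < c := by
          have h1 : (2 * (L : ℝ)) * (c / (2 * L + 1)) ≤ c := by
            rw [mul_div_assoc', div_le_iff₀ (by positivity)]; nlinarith
          nlinarith
  -- one-sided estimate
  have est : ∀ u : E, ‖u‖ = 1 → inner ℝ p u = 0 → f (p + t • u) ≤ f p + L * t ^ 2 := by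
    intro u hu hpu
    set N := ‖p + t • u‖ with hN
    have hN2 : N ^ 2 = 1 + t ^ 2 := by
      rw [hN, norm_add_sq_real, inner_smul_right, hpu, norm_smul, hp, hu, Real.norm_of_nonneg ht.le]
      ring
    have hN0 : 0 ≤ N := norm_nonneg _
    have hN1 : 1 ≤ N := by nlinarith
    have hN3 : N - 1 ≤ t ^ 2 := by nlinarith
    set q := N⁻¹ • (p + t • u) with hq
    have hqn : ‖q‖ = 1 := by
      rw [hq, norm_smul, norm_inv, Real.norm_of_nonneg hN0, ← hN, inv_mul_cancel₀ (by positivity)]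
    have hxN : p + t • u = N • q := by
      rw [hq, smul_smul, mul_inv_cancel₀ (by positivity), one_smul]
    have hd1 : dist (p + t • u) q = N - 1 := by
      rw [hxN, dist_eq_norm]
      have : N • q - q = (N - 1) • q := by module
      rw [this, norm_smul, hqn, Real.norm_of_nonneg (by linarith), mul_one]
    have hd2 : dist (p + t • u) p = t := by
      rw [dist_eq_norm, add_sub_cancel_left, norm_smul, hu, Real.norm_of_nonneg ht.le, mul_one]
    have hd3 : dist q p ≤ 2 * t := by
      have := dist_triangle q (p + t • u) p
      rw [dist_comm q (p + t • u), hd1, hd2] at this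
      nlinarith
    have hqf := hmax q hqn (by linarith)
    have hxU : p + t • u ∈ U := hrU (by rw [Metric.mem_ball, hd2]; linarith)
    have hqU : q ∈ U := hrU (by rw [Metric.mem_ball]; linarith)
    have := hL.dist_le_mul _ hxU _ hqU
    rw [hd1, Real.dist_eq] at this
    have h1 := (le_abs_self _).trans this
    have h2 : (L : ℝ) * (N - 1) ≤ L * t ^ 2 := by gcongr
    linarith
  have e1 := est v hv hpv
  have e2 := est (-v) (by simpa) (by simpa)
  have e3 := hk t ht
  rw [smul_neg, ← sub_eq_add_neg] at e2
  nlinarith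

end aux

theorem propertyZ_implies_simplicial (d : ℕ) (hd : 2 ≤ d)
    (V : Set (EuclideanSpace ℝ (Fin d))) (hfin : V.Finite)
    (hVsph : V ⊆ Metric.sphere 0 1)
    (hdim : affineSpan ℝ V = ⊤)
    (hvert : (convexHull ℝ V).extremePoints ℝ = V)
    (hZ : PropertyZ V) :
    ∀ F : Set (EuclideanSpace ℝ (Fin d)), IsFacet (convexHull ℝ V) F →
      (F.extremePoints ℝ).ncard = d ∧
      AffineIndependent ℝ ((↑) : F.extremePoints ℝ → EuclideanSpace ℝ (Fin d)) := by
  intro F hF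
  obtain ⟨hexp, hrank⟩ := hF
  have hPc : IsCompact (convexHull ℝ V) := hfin.isCompact_convexHull ℝ
  have hFne : F.Nonempty := by
    by_contra h
    rw [Set.not_nonempty_iff_eq_empty] at h
    subst h
    rw [AffineSubspace.span_empty, AffineSubspace.direction_bot, finrank_bot] at hrank
    omega
  have hW : F.extremePoints ℝ = F ∩ V := by
    rw [hexp.isExtreme.extremePoints_eq, hvert]
  have hFc : IsCompact F := hexp.isCompact hPc
  have hFconv : Convex ℝ F := hexp.convex (convex_convexHull ℝ V)
  set W := F.extremePoints ℝ with hWdef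
  have hWfin : W.Finite := by rw [hW]; exact hfin.subset Set.inter_subset_right
  have hFW : F = convexHull ℝ W := by
    rw [← closure_convexHull_extremePoints hFc hFconv]
    exact (hWfin.isCompact_convexHull ℝ).isClosed.closure_eq
  have hspan : affineSpan ℝ F = affineSpan ℝ W := by
    conv_lhs => rw [hFW]
    exact affineSpan_convexHull W
  have hWne : W.Nonempty := by
    rw [← convexHull_nonempty_iff (𝕜 := ℝ), ← hFW]; exact hFne
  have hind : AffineIndependent ℝ ((↑) : W → EuclideanSpace ℝ (Fin d)) := by
    by_contra hnot
    obtain ⟨t, htW, htspan, htind⟩ := exists_affineIndependent ℝ (EuclideanSpace ℝ (Fin d)) W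
    have hne : t ≠ W := by rintro rfl; exact hnot htind
    obtain ⟨p, hpW, hpt⟩ := Set.exists_of_ssubset (htW.ssubset_of_ne hne)
    have htsub : t ⊆ W \ {p} := fun x hx => ⟨htW hx, by rintro rfl; exact hpt hx⟩
    have hspan' : affineSpan ℝ (W \ {p}) = affineSpan ℝ W :=
      le_antisymm (affineSpan_mono ℝ Set.sdiff_subset) (htspan ▸ affineSpan_mono ℝ htsub)
    have hWpne : (W \ {p}).Nonempty := by
      rw [← affineSpan_nonempty ℝ, hspan']
      exact (affineSpan_nonempty ℝ).2 hWne
    have hpV : p ∈ V := (hW ▸ hpW : p ∈ F ∩ V).2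
    have hpF : p ∈ F := (hW ▸ hpW : p ∈ F ∩ V).1
    have hp1 : ‖p‖ = 1 := by simpa using hVsph hpV
    obtain ⟨n, hn⟩ := hexp hFne
    have hnF : ∀ x ∈ F, n x = n p := by
      intro x hx
      have h1 := hx; have h2 := hpF
      rw [hn] at h1 h2
      exact le_antisymm (h2.2 x h1.1) (h1.2 p h2.1)
    have hnP : ∀ x ∈ convexHull ℝ V, n x ≤ n p := by
      have h2 := hpF
      rw [hn] at h2
      exact h2.2
    have hfd : Module.finrank ℝ (EuclideanSpace ℝ (Fin d)) = d := by simp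
    have hn0 : n ≠ 0 := by
      rintro rfl
      have : F = convexHull ℝ V := by rw [hn]; ext x; simp
      rw [this, affineSpan_convexHull, hdim, AffineSubspace.direction_top, finrank_top, hfd] at hrank
      omega
    -- affine span of `F` is the hyperplane
    have hker : Module.finrank ℝ (LinearMap.ker n.toLinearMap) + 1 = d := by
      have := Module.Dual.finrank_ker_add_one_of_ne_zero (f := n.toLinearMap)
        (by intro h; apply hn0; ext x; exact congrArg (fun g => g x) h)
      exact this.trans hfd
    have hdir : (affineSpan ℝ F).direction = LinearMap.ker n.toLinearMap := by
      apply Submodule.eq_of_le_of_finrank_eq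
      · rw [direction_affineSpan, vectorSpan_def, Submodule.span_le]
        rintro _ ⟨x, hx, y, hy, rfl⟩
        simp [hnF x hx, hnF y hy]
      · omega
    have hmem : ∀ x, n x = n p → x ∈ affineSpan ℝ F := by
      intro x hx
      have : x -ᵥ p ∈ (affineSpan ℝ F).direction := by
        rw [hdir]; simp [hx]
      have := AffineSubspace.vadd_mem_of_mem_direction this (mem_affineSpan ℝ hpF)
      simpa using this
    -- the direction of motion
    have hdirn : ∃ v : EuclideanSpace ℝ (Fin d), ‖v‖ = 1 ∧ inner ℝ p v = 0 ∧ 0 < n v := by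
      by_contra hno
      have hzero : ∀ u : EuclideanSpace ℝ (Fin d), inner ℝ p u = 0 → n u = 0 := by
        have hle : ∀ u : EuclideanSpace ℝ (Fin d), inner ℝ p u = 0 → n u ≤ 0 := by
          intro u hu
          by_contra hpos
          push Not at hpos
          have hu0 : u ≠ 0 := by rintro rfl; simp at hpos
          have hu1 : 0 < ‖u‖ := norm_pos_iff.2 hu0
          refine hno ⟨‖u‖⁻¹ • u, ?_, ?_, ?_⟩
          · rw [norm_smul, norm_inv, norm_norm, inv_mul_cancel₀ hu1.ne']
          · rw [inner_smul_right, hu, mul_zero]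
          · rw [map_smul, smul_eq_mul]; positivity
        intro u hu
        have h1 := hle u hu
        have h2 := hle (-u) (by simpa using hu)
        rw [map_neg] at h2
        linarith
      have hform : ∀ x, n x = inner ℝ p x * n p := by
        intro x
        have := hzero (x - (inner ℝ p x : ℝ) • p) (by
          rw [inner_sub_right, inner_smul_right, real_inner_self_eq_norm_sq, hp1]; ring)
        rw [map_sub, map_smul, smul_eq_mul] at this
        linarith
      have hnp : n p ≠ 0 := by
        intro h
        apply hn0
        ext x
        rw [hform x, h]; simp
      have hWp : W ⊆ {p} := by
        intro w hw
        have hw' : w ∈ F ∩ V := hW ▸ hw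
        have h1 := hnF w hw'.1
        rw [hform w] at h1
        have h2 : inner ℝ p w = (1 : ℝ) := by
          exact mul_right_cancel₀ hnp (by rw [h1, one_mul])
        have hw1 : ‖w‖ = 1 := by simpa using hVsph hw'.2
        exact ((inner_eq_one_iff_of_norm_eq_one hp1 hw1).1 h2).symm
      obtain ⟨w, hw, hwp⟩ := hWpne
      exact hwp (hWp hw)
    obtain ⟨v, hv1, hpv, hnv⟩ := hdirn
    set T := V \ {p} with hT
    have hTfin : T.Finite := hfin.subset Set.sdiff_subset
    have hWT : W \ {p} ⊆ T := by
      intro x hx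
      exact ⟨(hW ▸ hx.1 : x ∈ F ∩ V).2, hx.2⟩
    have hTne : T.Nonempty := hWpne.mono hWT
    -- relative interior point
    obtain ⟨g, hg⟩ := Set.Nonempty.intrinsicInterior (convex_convexHull ℝ (W \ {p}))
      ((convexHull_nonempty_iff (𝕜 := ℝ)).2 hWpne)
    have hsp : affineSpan ℝ (convexHull ℝ (W \ {p})) = affineSpan ℝ F := by
      rw [affineSpan_convexHull, hspan', hspan]
    have hgn : n g = n p := by
      apply hnF
      rw [hFW]
      exact convexHull_mono Set.sdiff_subset (intrinsicInterior_subset hg)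
    obtain ⟨y, hy, rfl⟩ := mem_intrinsicInterior.1 hg
    obtain ⟨δ, hδ, hδ'⟩ := Metric.mem_nhds_iff.1 (mem_interior_iff_mem_nhds.1 hy)
    have hball : ∀ x, n x = n p → dist x (y : EuclideanSpace ℝ (Fin d)) < δ →
        x ∈ convexHull ℝ T := by
      intro x hx hxd
      have hx' : x ∈ affineSpan ℝ (convexHull ℝ (W \ {p})) := by rw [hsp]; exact hmem x hx
      exact convexHull_mono hWT (hδ' (show (⟨x, hx'⟩ : affineSpan ℝ _) ∈ Metric.ball y δ from hxd))
    obtain ⟨c, hc, hk⟩ := kink hTfin n hnv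
      (fun z hz => hnP z (subset_convexHull ℝ V hz.1)) hδ hgn hball
    obtain ⟨ε, hε, hmax⟩ := hZ p hpV
    have hins : insert p T = V := by rw [hT, Set.insert_sdiff_singleton, Set.insert_eq_of_mem hpV]
    refine no_local_max (convexOn_volFn hTne hTfin) hp1 hv1 hpv hc hk hε fun q hq hqd => ?_
    have := hmax q (by simpa using hq) hqd
    rw [Set.union_singleton] at this
    simp only [volFn, hins]
    exact ENNReal.toReal_mono hPc.measure_lt_top.ne this
  refine ⟨?_, hind⟩
  have : Fintype W := hWfin.fintype
  have : Nonempty W := hWne.to_subtype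
  have := hind.finrank_vectorSpan_add_one
  rw [Subtype.range_coe, ← direction_affineSpan, ← hspan, hrank] at this
  rw [← Nat.card_coe_set_eq, Nat.card_eq_fintype_card, ← this]
  omega
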